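/- arXiv:1906.09523 — 2 statements merged into one kernel-verified Lean document; each statement's English description precedes it below -/
import Mathlib

section
/- Let V be a finite-dimensional complex vector space, T nilpotent, and x ∈ V nonzero with cyclic invariant subspace U_x = span{T^k x : k ≥ 0}. Then the triple (V, T, U_x) is indecomposable if and only if card(gs(x)) = dim(ker T). -/
open Polynomial

variable {V : Type*} [AddCommGroup V] [Module ℂ V]

/-- The value `v(x)`: the largest `n` with `x ∈ T^n(V)`. -/
noncomputable def val (T : V →ₗ[ℂ] V) (x : V) : ℕ :=
  sSup {n : ℕ | x ∈ LinearMap.range (T ^ n)}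

/-- The value `v_U(x)` computed in a subspace `U`: the largest `n` with `x ∈ T^n(U)`. -/
noncomputable def valU (T : V →ₗ[ℂ] V) (U : Submodule ℂ V) (x : V) : ℕ :=
  sSup {n : ℕ | x ∈ Submodule.map (T ^ n) U}

/-- The height `ht(x)`: the least `n` with `T^n x = 0`. -/
noncomputable def ht (T : V →ₗ[ℂ] V) (x : V) : ℕ :=
  sInf {n : ℕ | (T ^ n) x = 0}

/-- The gap sequence of `x`. -/
noncomputable def gs (T : V →ₗ[ℂ] V) (x : V) : Set ℕ :=
  {k | (T ^ (k + 1)) x ≠ 0 ∧ val T ((T ^ (k + 1)) x) > val T ((T ^ k) x) + 1}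
    ∪ {ht T x - 1}

/-- The value sequence of `x`. -/
noncomputable def vs (T : V →ₗ[ℂ] V) (x : V) : Set ℕ :=
  (fun k => val T ((T ^ k) x)) '' gs T x

/-- The value-preserving property of a family of vectors, relative to a subspace `U`
(taking `U = ⊤` gives the value-preserving property in `V`). -/
def VP {ι : Type*} (T : V →ₗ[ℂ] V) (U : Submodule ℂ V) (x : ι → V) : Prop :=
  ∀ (s : Finset ι) (α : ι → ℂ) (hs : s.Nonempty), (∀ j ∈ s, α j ≠ 0) →
    valU T U (∑ j ∈ s, α j • x j) = s.inf' hs (fun j => valU T U (x j))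

/-- The triple `(V, T, U)` is indecomposable. -/
def Indecomposable (T : V →ₗ[ℂ] V) (U : Submodule ℂ V) : Prop :=
  ∀ V₁ V₂ : Submodule ℂ V, (∀ x ∈ V₁, T x ∈ V₁) → (∀ x ∈ V₂, T x ∈ V₂) →
    IsCompl V₁ V₂ → U = (U ⊓ V₁) ⊔ (U ⊓ V₂) → V₁ = ⊥ ∨ V₂ = ⊥

/-- `y` is `T`-consistent. -/
def TConsistent (T : V →ₗ[ℂ] V) (y : V) : Prop :=
  ∀ k < ht T y, val T ((T ^ k) y) = val T y + k

/-- The cyclic invariant subspace generated by `x`. -/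
noncomputable def cyc (T : V →ₗ[ℂ] V) (x : V) : Submodule ℂ V :=
  Submodule.span ℂ (Set.range fun k : ℕ => (T ^ k) x)

/-- The span `V(Y)` of the orbits of a family `y`. -/
noncomputable def VY (T : V →ₗ[ℂ] V) {r : ℕ} (y : Fin r → V) : Submodule ℂ V :=
  Submodule.span ℂ (⋃ i, (fun k => (T ^ k) (y i)) '' Set.Iio (ht T (y i)))


section Helpers

lemma R_anti (T : V →ₗ[ℂ] V) {m n : ℕ} (h : m ≤ n) :
    LinearMap.range (T ^ n) ≤ LinearMap.range (T ^ m) := by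
  rintro _ ⟨y, rfl⟩
  obtain ⟨d, rfl⟩ := Nat.exists_eq_add_of_le h
  exact ⟨(T ^ d) y, by rw [pow_add]; rfl⟩

lemma R_pow (T : V →ₗ[ℂ] V) {n : ℕ} (j : ℕ) {y : V} (h : y ∈ LinearMap.range (T ^ n)) :
    (T ^ j) y ∈ LinearMap.range (T ^ (n + j)) := by
  obtain ⟨z, rfl⟩ := h
  exact ⟨z, by rw [add_comm, pow_add]; rfl⟩

lemma R_comm (T S : V →ₗ[ℂ] V) (hS : Commute S T) {n : ℕ} {y : V}
    (h : y ∈ LinearMap.range (T ^ n)) : S y ∈ LinearMap.range (T ^ n) := by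
  obtain ⟨z, rfl⟩ := h
  refine ⟨S z, ?_⟩
  have := (hS.pow_right n).eq
  exact (LinearMap.congr_fun this z).symm

lemma val_iff (T : V →ₗ[ℂ] V) (hT : IsNilpotent T) {y : V} (hy : y ≠ 0) (m : ℕ) :
    y ∈ LinearMap.range (T ^ m) ↔ m ≤ val T y := by
  obtain ⟨N, hN⟩ := hT
  have hb : BddAbove {n : ℕ | y ∈ LinearMap.range (T ^ n)} := by
    refine ⟨N, fun n hn => ?_⟩
    by_contra hlt
    have h1 := R_anti T (le_of_not_ge hlt) hn
    rw [hN] at h1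
    obtain ⟨z, hz⟩ := h1
    exact hy (by simpa using hz.symm)
  constructor
  · intro h
    exact le_csSup hb h
  · intro h
    have hmem : val T y ∈ {n : ℕ | y ∈ LinearMap.range (T ^ n)} :=
      Nat.sSup_mem ⟨0, by simp⟩ hb
    exact R_anti T h hmem

lemma ht_spec (T : V →ₗ[ℂ] V) (hT : IsNilpotent T) (x : V) (hx : x ≠ 0) (k : ℕ) :
    k = ht T x - 1 ↔ ((T ^ k) x ≠ 0 ∧ (T ^ (k + 1)) x = 0) := by
  obtain ⟨N, hN⟩ := hT
  have hmem : (T ^ (ht T x)) x = 0 :=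
    Nat.sInf_mem (s := {n : ℕ | (T ^ n) x = 0}) ⟨N, by simp [hN]⟩
  have hlt : ∀ j, j < ht T x → (T ^ j) x ≠ 0 := fun j hj =>
    Nat.notMem_of_lt_sInf (s := {n : ℕ | (T ^ n) x = 0}) hj
  have hle : ∀ j, (T ^ j) x = 0 → ht T x ≤ j := fun j hj =>
    Nat.sInf_le (s := {n : ℕ | (T ^ n) x = 0}) hj
  have hpos : ht T x ≠ 0 := by
    intro h0
    rw [h0] at hmem
    exact hx (by simpa using hmem)
  constructor
  · rintro rfl
    refine ⟨hlt _ (by omega), ?_⟩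
    rwa [show ht T x - 1 + 1 = ht T x by omega]
  · rintro ⟨h1, h2⟩
    have h3 := hle _ h2
    have h4 : ¬ ht T x ≤ k := by
      intro h
      apply h1
      obtain ⟨d, rfl⟩ := Nat.exists_eq_add_of_le h
      rw [add_comm, pow_add, Module.End.mul_apply, hmem, map_zero]
    omega

lemma mem_gs (T : V →ₗ[ℂ] V) (hT : IsNilpotent T) (x : V) (hx : x ≠ 0) (k : ℕ) :
    k ∈ gs T x ↔ ((T ^ k) x ≠ 0 ∧
      (T ^ (k + 1)) x ∈ LinearMap.range (T ^ (val T ((T ^ k) x) + 2))) := by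
  have hs := ht_spec T hT x hx k
  constructor
  · rintro (⟨h1, h2⟩ | h)
    · refine ⟨?_, (val_iff T hT h1 _).2 h2⟩
      intro h0
      apply h1
      rw [pow_succ', Module.End.mul_apply, h0, map_zero]
    · obtain ⟨h1, h2⟩ := hs.1 h
      exact ⟨h1, by rw [h2]; exact Submodule.zero_mem _⟩
  · rintro ⟨h1, h2⟩
    by_cases h : (T ^ (k + 1)) x = 0
    · exact Or.inr (hs.2 ⟨h1, h⟩)
    · exact Or.inl ⟨h, (val_iff T hT h _).1 h2⟩

lemma gs_finite (T : V →ₗ[ℂ] V) (hT : IsNilpotent T) (x : V) (hx : x ≠ 0) :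
    (gs T x).Finite := by
  have hT' := hT
  obtain ⟨N, hN⟩ := hT
  refine (Set.finite_Iio N).subset fun k hk => ?_
  have := ((mem_gs T hT' x hx k).1 hk).1
  by_contra h
  apply this
  rw [pow_eq_zero_of_le (by simpa using h) hN]
  rfl

lemma exists_w (T : V →ₗ[ℂ] V) (hT : IsNilpotent T) (x : V) (hx : x ≠ 0) (k : ℕ)
    (hk : k ∈ gs T x) : ∃ w, T w = 0 ∧
      w - (T ^ k) x ∈ LinearMap.range (T ^ (val T ((T ^ k) x) + 1)) := by
  obtain ⟨_, z, hz⟩ := (mem_gs T hT x hx k).1 hk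
  refine ⟨(T ^ k) x - (T ^ (val T ((T ^ k) x) + 1)) z, ?_, ?_⟩
  · rw [map_sub, ← Module.End.mul_apply, ← pow_succ', ← hz, ← Module.End.mul_apply, ← pow_succ']
    simp
  · rw [sub_sub_cancel_left]
    exact Submodule.neg_mem _ ⟨z, rfl⟩

lemma linInd (T : V →ₗ[ℂ] V) (hT : IsNilpotent T) (x : V) (hx : x ≠ 0) (w : gs T x → V)
    (hw : ∀ k : gs T x, w k - (T ^ (k : ℕ)) x ∈
      LinearMap.range (T ^ (val T ((T ^ (k : ℕ)) x) + 1))) : LinearIndependent ℂ w := by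
  classical
  rw [linearIndependent_iff']
  intro s g hsum
  have key : ∀ k : ℕ, ∀ hk : k ∈ gs T x, (⟨k, hk⟩ : gs T x) ∈ s → g ⟨k, hk⟩ = 0 := by
    intro k
    induction k using Nat.strong_induction_on with
    | _ k ih =>
      intro hk hks
      by_contra hg
      have hne : (T ^ k) x ≠ 0 := ((mem_gs T hT x hx k).1 hk).1
      rw [← Finset.add_sum_erase s _ hks] at hsum
      have hrest : ∑ i ∈ s.erase ⟨k, hk⟩, g i • w i ∈
          LinearMap.range (T ^ (val T ((T ^ k) x) + 1)) := by
        refine Submodule.sum_mem _ fun i hi => ?_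
        obtain ⟨hik, his⟩ := Finset.mem_erase.1 hi
        rcases lt_trichotomy (i : ℕ) k with h | h | h
        · rw [ih i h i.2 his, zero_smul]
          exact Submodule.zero_mem _
        · exact absurd (Subtype.ext h) hik
        · refine Submodule.smul_mem _ _ ?_
          have hine : (T ^ (i : ℕ)) x ≠ 0 := ((mem_gs T hT x hx i).1 i.2).1
          obtain ⟨d, hd⟩ := Nat.exists_eq_add_of_le h
          have h1 : (T ^ (i : ℕ)) x ∈ LinearMap.range (T ^ (val T ((T ^ k) x) + 1)) := by
            have h2 := R_pow T (1 + d) ((val_iff T hT hne _).2 le_rfl)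
            rw [← Module.End.mul_apply, ← pow_add, show 1 + d + k = i by omega] at h2
            exact R_anti T (by omega) h2
          have h3 := (val_iff T hT hine _).1 h1
          have h4 := Submodule.add_mem _ (R_anti T (by omega) (hw i)) h1
          simpa using h4
      have h5 : g ⟨k, hk⟩ • w ⟨k, hk⟩ ∈ LinearMap.range (T ^ (val T ((T ^ k) x) + 1)) := by
        rw [eq_neg_of_add_eq_zero_left hsum]
        exact Submodule.neg_mem _ hrest
      rw [Submodule.smul_mem_iff _ hg] at h5
      have h6 := Submodule.sub_mem _ h5 (hw ⟨k, hk⟩)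
      simp only [sub_sub_cancel] at h6
      have h7 := (val_iff T hT hne _).1 h6
      omega
  intro i hi
  exact key i i.2 hi

lemma unit_aeval (T : V →ₗ[ℂ] V) (hT : IsNilpotent T) (p : ℂ[X]) (hp : p.coeff 0 ≠ 0) :
    IsUnit (aeval T p) := by
  have h : aeval T p = T * aeval T p.divX + algebraMap ℂ _ (p.coeff 0) := by
    have h0 := congrArg (aeval T) (X_mul_divX_add p)
    rw [map_add, map_mul, aeval_X, aeval_C] at h0
    exact h0.symm
  rw [h]
  have hc : Commute T (aeval T p.divX) := by
    have := (Commute.all (X : ℂ[X]) p.divX).map (aeval T)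
    simpa using this
  have hn : IsNilpotent (T * aeval T p.divX) := hc.isNilpotent_mul_right hT
  have hu : IsUnit (algebraMap ℂ (V →ₗ[ℂ] V) (p.coeff 0)) :=
    (isUnit_iff_ne_zero.2 hp).map _
  exact hn.isUnit_add_right_of_commute hu (Algebra.commutes _ _).symm

lemma mem_cyc (T : V →ₗ[ℂ] V) (x u : V) : u ∈ cyc T x ↔ ∃ p : ℂ[X], aeval T p x = u := by
  constructor
  · intro hu
    refine Submodule.span_induction ?_ ?_ ?_ ?_ hu
    · rintro _ ⟨k, rfl⟩
      exact ⟨X ^ k, by simp⟩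
    · exact ⟨0, by simp⟩
    · rintro a b _ _ ⟨p, rfl⟩ ⟨q, rfl⟩
      exact ⟨p + q, by simp⟩
    · rintro c a _ ⟨p, rfl⟩
      exact ⟨c • p, by simp⟩
  · rintro ⟨p, rfl⟩
    rw [aeval_eq_sum_range, LinearMap.sum_apply]
    exact Submodule.sum_mem _ fun i _ => Submodule.smul_mem _ _ (Submodule.subset_span ⟨i, rfl⟩)

lemma comm_aeval (T : V →ₗ[ℂ] V) (p : ℂ[X]) : Commute (aeval T p) T := by
  have := (Commute.all p (X : ℂ[X])).map (aeval T)
  simpa using this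

lemma cyc_lead (T : V →ₗ[ℂ] V) (hT : IsNilpotent T) (x u : V) (n : ℕ) (hu : u ∈ cyc T x)
    (h1 : u ∈ LinearMap.range (T ^ n)) (h2 : u ∉ LinearMap.range (T ^ (n + 1))) :
    ∃ (i : ℕ) (c : ℂ), c ≠ 0 ∧ (T ^ i) x ∈ LinearMap.range (T ^ n) ∧
      (T ^ i) x ∉ LinearMap.range (T ^ (n + 1)) ∧
      u - c • (T ^ i) x ∈ LinearMap.range (T ^ (n + 1)) := by
  obtain ⟨p, rfl⟩ := (mem_cyc T x u).1 hu
  have hp : p ≠ 0 := by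
    rintro rfl
    apply h2
    simp
  obtain ⟨s, hs, hs'⟩ := exists_eq_pow_rootMultiplicity_mul_and_not_dvd p hp 0
  set i := p.rootMultiplicity 0
  simp only [map_zero, sub_zero] at hs hs'
  have hc : s.coeff 0 ≠ 0 := fun h => hs' (X_dvd_iff.2 h)
  have hu' : aeval T p x = aeval T s ((T ^ i) x) := by
    rw [hs, mul_comm]
    simp
  rw [hu'] at h1 h2 ⊢
  have hmem : (T ^ i) x ∈ LinearMap.range (T ^ n) := by
    obtain ⟨g, hg⟩ := unit_aeval T hT s hc
    have hcm : Commute ((g⁻¹ : (V →ₗ[ℂ] V)ˣ) : V →ₗ[ℂ] V) T := by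
      apply Commute.units_inv_left
      rw [hg]
      exact comm_aeval T s
    have h3 := R_comm T _ hcm h1
    rw [← hg, ← Module.End.mul_apply, Units.inv_mul] at h3
    exact h3
  refine ⟨i, s.coeff 0, hc, hmem, fun h => h2 (R_comm T _ (comm_aeval T s) h), ?_⟩
  have h : aeval T s = T * aeval T s.divX + algebraMap ℂ _ (s.coeff 0) := by
    have h0 := congrArg (aeval T) (X_mul_divX_add s)
    rw [map_add, map_mul, aeval_X, aeval_C] at h0
    exact h0.symm
  rw [h, LinearMap.add_apply, Module.algebraMap_end_apply, add_sub_cancel_right,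
    Module.End.mul_apply]
  simpa using R_pow T 1 (R_comm T _ (comm_aeval T s.divX) hmem)

/-- If the socle filtration is covered by `cyc T x`, the vectors `w` span the kernel. -/
lemma ker_le_span (T : V →ₗ[ℂ] V) (hT : IsNilpotent T) (x : V) (hx : x ≠ 0) (w : gs T x → V)
    (hw0 : ∀ k, T (w k) = 0)
    (hw : ∀ k : gs T x, w k - (T ^ (k : ℕ)) x ∈
      LinearMap.range (T ^ (val T ((T ^ (k : ℕ)) x) + 1)))
    (H : ∀ n y, T y = 0 → y ∈ LinearMap.range (T ^ n) →
      y ∈ cyc T x ⊔ LinearMap.range (T ^ (n + 1))) :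
    LinearMap.ker T ≤ Submodule.span ℂ (Set.range w) := by
  have hT' := hT
  obtain ⟨N, hN⟩ := hT
  have key : ∀ m n, N ≤ n + m → ∀ y, T y = 0 → y ∈ LinearMap.range (T ^ n) →
      y ∈ Submodule.span ℂ (Set.range w) := by
    intro m
    induction m with
    | zero =>
      intro n hn y _ hy
      rw [pow_eq_zero_of_le (by simpa using hn) hN] at hy
      obtain ⟨z, rfl⟩ := hy
      simp
    | succ m ih =>
      intro n hn y hy0 hy
      by_cases hy1 : y ∈ LinearMap.range (T ^ (n + 1))
      · exact ih (n + 1) (by omega) y hy0 hy1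
      obtain ⟨u, hu, r, hr, rfl⟩ := Submodule.mem_sup.1 (H n y hy0 hy)
      have hu1 : u ∈ LinearMap.range (T ^ n) := by
        have := Submodule.sub_mem _ hy (R_anti T (Nat.le_succ n) hr)
        simpa using this
      have hu2 : u ∉ LinearMap.range (T ^ (n + 1)) := fun h => hy1 (Submodule.add_mem _ h hr)
      obtain ⟨i, c, hc, h1, h2, h3⟩ := cyc_lead T hT' x u n hu hu1 hu2
      have hne : (T ^ i) x ≠ 0 := by
        intro h
        rw [h] at h2
        exact h2 (Submodule.zero_mem _)
      have hval : val T ((T ^ i) x) = n := by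
        rw [val_iff T hT' hne] at h1 h2
        omega
      have h4 : u + r - c • (T ^ i) x ∈ LinearMap.range (T ^ (n + 1)) := by
        have := Submodule.add_mem _ h3 hr
        rwa [show u - c • (T ^ i) x + r = u + r - c • (T ^ i) x by abel] at this
      have hi : i ∈ gs T x := by
        rw [mem_gs T hT' x hx]
        refine ⟨hne, ?_⟩
        rw [hval]
        have h5 := R_pow T 1 h4
        rw [pow_one, map_sub, hy0, zero_sub, Submodule.neg_mem_iff, map_smul,
          Submodule.smul_mem_iff _ hc, ← Module.End.mul_apply, ← pow_succ'] at h5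
        exact h5
      have h6 := hw ⟨i, hi⟩
      simp only [hval] at h6
      have h7 : u + r - c • w ⟨i, hi⟩ ∈ LinearMap.range (T ^ (n + 1)) := by
        have := Submodule.sub_mem _ h4 (Submodule.smul_mem _ c h6)
        rwa [show u + r - c • (T ^ i) x - c • (w ⟨i, hi⟩ - (T ^ i) x)
          = u + r - c • w ⟨i, hi⟩ by rw [smul_sub]; abel] at this
      have h8 := ih (n + 1) (by omega) _ (by rw [map_sub, hy0, map_smul, hw0]; simp) h7
      have h9 := Submodule.add_mem _ h8
        (Submodule.smul_mem _ c (Submodule.subset_span (Set.mem_range_self ⟨i, hi⟩)))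
      simpa using h9
  intro y hy
  exact key N 0 (by omega) y hy (by simp)

/-- A socle element not covered splits off a cyclic summand. -/
lemma split_off (T : V →ₗ[ℂ] V) (x z : V) (n : ℕ)
    (hz : (T ^ (n + 1)) z = 0) (hz' : (T ^ n) z ∉ cyc T x ⊔ LinearMap.range (T ^ (n + 1))) :
    ∃ V₁ V₂ : Submodule ℂ V, (∀ x ∈ V₁, T x ∈ V₁) ∧ (∀ x ∈ V₂, T x ∈ V₂) ∧
      IsCompl V₁ V₂ ∧ cyc T x ≤ V₁ ∧ V₂ ≠ ⊥ := by
  obtain ⟨φ, hφ, hφ0⟩ := Submodule.exists_le_ker_of_notMem hz'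
  have hφR : ∀ k, n < k → ∀ y, φ ((T ^ k) y) = 0 := fun k hk y =>
    hφ0 (Submodule.mem_sup_right (R_anti T hk ⟨y, rfl⟩))
  have hzk : ∀ k, n < k → (T ^ k) z = 0 := by
    intro k hk
    obtain ⟨d, rfl⟩ := Nat.exists_eq_add_of_le hk
    rw [Nat.succ_eq_add_one, add_comm, pow_add, Module.End.mul_apply, hz, map_zero]
  let Φ : V →ₗ[ℂ] (Fin (n + 1) → ℂ) := LinearMap.pi fun k => φ ∘ₗ (T ^ (k : ℕ))
  let Ψ : (Fin (n + 1) → ℂ) →ₗ[ℂ] V := Fintype.linearCombination ℂ fun k => (T ^ (k : ℕ)) z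
  have hΨ : ∀ a, Ψ a = ∑ j, a j • (T ^ (j : ℕ)) z := fun a => rfl
  have hΦ : ∀ v k, Φ v k = φ ((T ^ (k : ℕ)) v) := fun a k => rfl
  have hΦ0 : ∀ v, v ∈ LinearMap.ker Φ ↔ ∀ k, φ ((T ^ k) v) = 0 := by
    intro v
    rw [LinearMap.mem_ker, funext_iff]
    constructor
    · intro h k
      by_cases hk : n < k
      · exact hφR k hk v
      · exact h ⟨k, by omega⟩
    · intro h k
      exact h k
  have hinj : Function.Injective (Φ ∘ₗ Ψ) := by
    rw [← LinearMap.ker_eq_bot, LinearMap.ker_eq_bot']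
    intro a ha
    have ha' := (hΦ0 (Ψ a)).1 ha
    have key : ∀ j : ℕ, ∀ hj : j < n + 1, a ⟨j, hj⟩ = 0 := by
      intro j
      induction j using Nat.strong_induction_on with
      | _ j ih =>
        intro hj
        have h1 := ha' (n - j)
        rw [hΨ, map_sum, map_sum, Finset.sum_eq_single ⟨j, hj⟩] at h1
        · rw [map_smul, map_smul, ← Module.End.mul_apply, ← pow_add] at h1
          simp only [show n - j + j = n by omega, smul_eq_mul] at h1
          exact (mul_eq_zero.1 h1).resolve_right hφ
        · intro b _ hb
          rcases lt_trichotomy (b : ℕ) j with h | h | h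
          · rw [show a b = 0 from ih b h b.2]
            simp
          · exact absurd (Fin.ext h) hb
          · rw [map_smul, map_smul, ← Module.End.mul_apply, ← pow_add, hzk _ (by omega)]
            simp
        · simp
    funext j
    exact key j j.2
  have hsurj : Function.Surjective (Φ ∘ₗ Ψ) := LinearMap.injective_iff_surjective.1 hinj
  have hmemΨ : ∀ k, (T ^ k) z ∈ LinearMap.range Ψ := by
    intro k
    by_cases hk : n < k
    · rw [hzk k hk]
      exact Submodule.zero_mem _
    · refine ⟨Pi.single ⟨k, by omega⟩ 1, ?_⟩
      rw [hΨ, Finset.sum_eq_single ⟨k, by omega⟩]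
      · simp
      · intro b _ hb
        simp [hb]
      · simp
  refine ⟨LinearMap.ker Φ, LinearMap.range Ψ, ?_, ?_, ⟨?_, ?_⟩, ?_, ?_⟩
  · intro v hv
    rw [hΦ0] at hv ⊢
    intro k
    rw [← Module.End.mul_apply, ← pow_succ]
    exact hv _
  · rintro _ ⟨a, rfl⟩
    rw [hΨ, map_sum]
    refine Submodule.sum_mem _ fun j _ => ?_
    rw [map_smul, ← Module.End.mul_apply, ← pow_succ']
    exact Submodule.smul_mem _ _ (hmemΨ _)
  · rw [Submodule.disjoint_def]
    rintro _ h ⟨a, rfl⟩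
    have : a = 0 := hinj (by rw [map_zero]; exact h)
    rw [this, map_zero]
  · rw [codisjoint_iff, eq_top_iff]
    intro v _
    obtain ⟨a, ha⟩ := hsurj (Φ v)
    refine Submodule.mem_sup.2 ⟨v - Ψ a, ?_, Ψ a, ⟨a, rfl⟩, by simp⟩
    rw [LinearMap.mem_ker, map_sub, ← ha]
    simp
  · refine Submodule.span_le.2 ?_
    rintro _ ⟨j, rfl⟩
    refine (hΦ0 _).2 fun k => hφ0 (Submodule.mem_sup_left (Submodule.subset_span ⟨k + j, ?_⟩))
    simp only [pow_add, Module.End.mul_apply]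
  · intro h
    have := hmemΨ n
    rw [h, Submodule.mem_bot] at this
    rw [this] at hφ
    simp at hφ

/-- If `x` lies in a summand, and the gap count is the dimension of the kernel,
then the complementary summand is trivial. -/
lemma summand_trivial [FiniteDimensional ℂ V] (T : V →ₗ[ℂ] V) (hT : IsNilpotent T)
    (x : V) (hx : x ≠ 0) (hcard : (gs T x).ncard = Module.finrank ℂ (LinearMap.ker T))
    (V₁ V₂ : Submodule ℂ V) (h1 : ∀ x ∈ V₁, T x ∈ V₁) (h2 : ∀ x ∈ V₂, T x ∈ V₂)
    (hc : IsCompl V₁ V₂) (hx1 : x ∈ V₁) : V₂ = ⊥ := by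
  classical
  have hπ : ∃ π : V →ₗ[ℂ] V, (∀ v ∈ V₁, π v = v) ∧ (∀ v, π v ∈ V₁) ∧ Commute π T := by
    have hL : ∀ v ∈ V₁, V₁.projection V₂ hc v = v := fun v hv => by
      exact Submodule.projection_apply_left hc ⟨v, hv⟩
    have hR : ∀ v ∈ V₂, V₁.projection V₂ hc v = 0 := fun v hv => by
      exact (Submodule.projection_apply_eq_zero_iff hc).2 hv
    refine ⟨V₁.projection V₂ hc, hL, fun v => Submodule.projection_apply_mem hc v, ?_⟩
    refine LinearMap.ext fun v => ?_
    have hv : v ∈ V₁ ⊔ V₂ := by rw [hc.sup_eq_top]; trivial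
    obtain ⟨a, ha, b, hb, rfl⟩ := Submodule.mem_sup.1 hv
    simp only [Module.End.mul_apply, map_add]
    rw [hL a ha, hR b hb, hL _ (h1 a ha), hR _ (h2 b hb), map_zero]
  obtain ⟨π, hπ1, hπ2, hπc⟩ := hπ
  have hw := fun k : gs T x => exists_w T hT x hx k k.2
  choose w hw0 hw using hw
  have hV1 : ∀ k : ℕ, (T ^ k) x ∈ V₁ := by
    intro k
    induction k with
    | zero => simpa using hx1
    | succ k ih =>
      rw [pow_succ', Module.End.mul_apply]
      exact h1 _ ih
  have hli : LinearIndependent ℂ (fun k => π (w k)) := by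
    apply linInd T hT x hx
    intro k
    have := R_comm T π hπc (hw k)
    rwa [map_sub, hπ1 _ (hV1 k)] at this
  have hker : ∀ k, T (π (w k)) = 0 := by
    intro k
    have := LinearMap.congr_fun hπc.eq (w k)
    simp only [Module.End.mul_apply, hw0, map_zero] at this
    exact this.symm
  have : Fintype (gs T x) := (gs_finite T hT x hx).fintype
  have hle : Submodule.span ℂ (Set.range fun k => π (w k)) ≤ LinearMap.ker T ⊓ V₁ := by
    rw [Submodule.span_le]
    rintro _ ⟨k, rfl⟩
    exact ⟨hker k, hπ2 _⟩
  have hfr := finrank_span_eq_card hli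
  have heq : LinearMap.ker T ⊓ V₁ = LinearMap.ker T := by
    apply Submodule.eq_of_le_of_finrank_le inf_le_left
    rw [← hcard, ← Nat.card_coe_set_eq, Nat.card_eq_fintype_card, ← hfr]
    exact Submodule.finrank_mono hle
  rw [inf_eq_left] at heq
  rw [Submodule.eq_bot_iff]
  obtain ⟨N, hN⟩ := hT
  have key : ∀ m, ∀ v ∈ V₂, (T ^ m) v = 0 → v = 0 := by
    intro m
    induction m with
    | zero => intro v _ h; simpa using h
    | succ m ih =>
      intro v hv h
      rw [pow_succ, Module.End.mul_apply] at h
      exact Submodule.disjoint_def.1 hc.disjoint v (heq (ih _ (h2 v hv) h)) hv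
  intro v hv
  exact key N v hv (by rw [hN]; rfl)

/-- The cyclic subspace, if decomposed, lies in one of the summands. -/
lemma mem_summand (T : V →ₗ[ℂ] V) (hT : IsNilpotent T)
    (x : V) (hx : x ≠ 0)
    (V₁ V₂ : Submodule ℂ V) (h1 : ∀ x ∈ V₁, T x ∈ V₁) (h2 : ∀ x ∈ V₂, T x ∈ V₂)
    (hc : cyc T x = (cyc T x ⊓ V₁) ⊔ (cyc T x ⊓ V₂)) : x ∈ V₁ ∨ x ∈ V₂ := by
  have hfin : ∀ (W : Submodule ℂ V), (∀ x ∈ W, T x ∈ W) → ∀ p : ℂ[X], p.coeff 0 ≠ 0 →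
      aeval T p x ∈ W → x ∈ W := by
    intro W hW p hp hmem
    have hN : ∃ N, (T ^ N) x ∈ W := by
      obtain ⟨N, hN⟩ := hT
      exact ⟨N, by rw [hN]; exact W.zero_mem⟩
    obtain ⟨N, hN⟩ := hN
    -- every `p(T)` maps `W` to itself
    have hpow : ∀ k : ℕ, ∀ v ∈ W, (T ^ k) v ∈ W := by
      intro k
      induction k with
      | zero => intro v hv; simpa using hv
      | succ k ih =>
        intro v hv
        rw [pow_succ', Module.End.mul_apply]
        exact hW _ (ih v hv)
    have hae : ∀ q : ℂ[X], ∀ v ∈ W, aeval T q v ∈ W := by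
      intro q v hv
      rw [aeval_eq_sum_range, LinearMap.sum_apply]
      exact Submodule.sum_mem _ fun i _ => Submodule.smul_mem _ _ (hpow i v hv)
    -- `p` is coprime to `X ^ N`
    have hcop : IsCoprime p (X ^ N) := by
      apply IsCoprime.pow_right
      refine ⟨C (p.coeff 0)⁻¹, - C (p.coeff 0)⁻¹ * p.divX, ?_⟩
      conv_lhs => enter [1, 2]; rw [← X_mul_divX_add p]
      have : C (p.coeff 0)⁻¹ * C (p.coeff 0) = (1 : ℂ[X]) := by
        rw [← C_mul, inv_mul_cancel₀ hp, C_1]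
      linear_combination this
    obtain ⟨a, b, hab⟩ := hcop
    have h3 := congrArg (fun q => aeval T q x) hab
    simp only [map_add, map_mul, map_one, LinearMap.add_apply, Module.End.mul_apply,
      Module.End.one_apply, aeval_X_pow] at h3
    rw [← h3]
    exact W.add_mem (hae _ _ hmem) (hae _ _ hN)
  have hxc : x ∈ cyc T x := Submodule.subset_span ⟨0, by simp⟩
  rw [hc] at hxc
  obtain ⟨u, ⟨hu, hu1⟩, v, ⟨hv, hv2⟩, huv⟩ := Submodule.mem_sup.1 hxc
  obtain ⟨p, rfl⟩ := (mem_cyc T x u).1 hu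
  obtain ⟨q, rfl⟩ := (mem_cyc T x v).1 hv
  by_cases hp : p.coeff 0 = 0
  · by_cases hq : q.coeff 0 = 0
    · exfalso
      have h4 := unit_aeval T hT (1 - p - q) (by simp [hp, hq])
      obtain ⟨g, hg⟩ := h4
      apply hx
      have h5 : aeval T (1 - p - q) x = 0 := by
        simp only [map_sub, map_one, LinearMap.sub_apply, Module.End.one_apply]
        rw [sub_sub, huv, sub_self]
      rw [← hg] at h5
      have h6 := congrArg ((g⁻¹ : (V →ₗ[ℂ] V)ˣ) : V →ₗ[ℂ] V) h5
      rw [← Module.End.mul_apply, Units.inv_mul, map_zero] at h6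
      exact h6
    · exact Or.inr (hfin V₂ h2 q hq hv2)
  · exact Or.inl (hfin V₁ h1 p hp hu1)

end Helpers

theorem stmt15 [FiniteDimensional ℂ V] (T : V →ₗ[ℂ] V) (hT : IsNilpotent T)
    (x : V) (hx : x ≠ 0) :
    Indecomposable T (cyc T x) ↔ (gs T x).ncard = Module.finrank ℂ (LinearMap.ker T) := by
  classical
  constructor
  · intro hind
    have H : ∀ n y, T y = 0 → y ∈ LinearMap.range (T ^ n) →
        y ∈ cyc T x ⊔ LinearMap.range (T ^ (n + 1)) := by
      rintro n _ hy ⟨z, rfl⟩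
      by_contra hcon
      rw [← Module.End.mul_apply, ← pow_succ'] at hy
      obtain ⟨V₁, V₂, h1, h2, hc, hle, hne⟩ := split_off T x z n hy hcon
      have hdec : cyc T x = (cyc T x ⊓ V₁) ⊔ (cyc T x ⊓ V₂) := by
        rw [inf_eq_left.2 hle, sup_eq_left.2 inf_le_left]
      rcases hind V₁ V₂ h1 h2 hc hdec with h | h
      · have hxc : x ∈ V₁ := hle (Submodule.subset_span ⟨0, by simp⟩)
        rw [h] at hxc
        exact hx (by simpa using hxc)
      · exact hne h
    have hw := fun k : gs T x => exists_w T hT x hx k k.2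
    choose w hw0 hw using hw
    have hli := linInd T hT x hx w hw
    have hsp := ker_le_span T hT x hx w hw0 hw H
    have heq : LinearMap.ker T = Submodule.span ℂ (Set.range w) := by
      refine le_antisymm hsp (Submodule.span_le.2 ?_)
      rintro _ ⟨k, rfl⟩
      exact hw0 k
    have : Fintype (gs T x) := (gs_finite T hT x hx).fintype
    rw [heq, finrank_span_eq_card hli, ← Nat.card_coe_set_eq, Nat.card_eq_fintype_card]
  · intro hcard V₁ V₂ h1 h2 hc hdec
    rcases mem_summand T hT x hx V₁ V₂ h1 h2 hdec with h | h
    · exact Or.inr (summand_trivial T hT x hx hcard V₁ V₂ h1 h2 hc h)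
    · exact Or.inl (summand_trivial T hT x hx hcard V₂ V₁ h2 h1 hc.symm h)
end

section
/- Let V be a finite-dimensional complex vector space, T nilpotent, and x, y nonzero vectors whose cyclic invariant subspaces U_x, U_y give indecomposable triples. Then (V, T, U_x) and (V, T, U_y) are similar (i.e., there is an invertible linear f : V → V with fT = Tf and f(U_x) = U_y) if and only if gs(x) = gs(y) and vs(x) = vs(y). -/
open Polynomial

variable {V : Type*} [AddCommGroup V] [Module ℂ V]

lemma aux_unit (p : ℂ[X]) (hp : ¬ X ∣ p) (n : ℕ) : ∃ r c : ℂ[X], p * r = 1 + X ^ n * c := by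
  have h : IsCoprime (X ^ n) p :=
    IsCoprime.pow_left ((Polynomial.irreducible_X.coprime_iff_not_dvd).2 hp)
  obtain ⟨a, b, hab⟩ := h
  exact ⟨b, -a, by linear_combination hab⟩

lemma aux_factor (p : ℂ[X]) (hp : p ≠ 0) : ∃ (a : ℕ) (q : ℂ[X]), p = X ^ a * q ∧ ¬ X ∣ q := by
  have h := Polynomial.exists_eq_pow_rootMultiplicity_mul_and_not_dvd p hp 0
  obtain ⟨q, h1, h2⟩ := h
  rw [C_0, sub_zero] at h1 h2
  exact ⟨_, q, h1, h2⟩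

lemma aux_mk_zero (n : ℕ) (p : ℂ[X]) :
    ((Submodule.span ℂ[X] {(X : ℂ[X]) ^ n}).mkQ p = 0) ↔ X ^ n ∣ p := by
  rw [Submodule.mkQ_apply, Submodule.Quotient.mk_eq_zero, Submodule.mem_span_singleton]
  constructor
  · rintro ⟨a, rfl⟩; exact Dvd.intro_left a rfl
  · rintro ⟨a, rfl⟩; exact ⟨a, by simp [mul_comm]⟩

lemma aux_hom (a m nj ni : ℕ) (p : ℂ[X]) (hp : ¬ X ∣ p) (ham : a ≤ m) (h : ni + a ≤ nj + m) :
    ∃ g : (ℂ[X] ⧸ Submodule.span ℂ[X] {(X : ℂ[X]) ^ nj}) →ₗ[ℂ[X]]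
        (ℂ[X] ⧸ Submodule.span ℂ[X] {(X : ℂ[X]) ^ ni}),
      g ((Submodule.span ℂ[X] {(X : ℂ[X]) ^ nj}).mkQ (X ^ a * p)) =
        (Submodule.span ℂ[X] {(X : ℂ[X]) ^ ni}).mkQ (X ^ m) := by
  obtain ⟨r, c, hr⟩ := aux_unit p hp ni
  have hle : Submodule.span ℂ[X] {(X : ℂ[X]) ^ nj} ≤
      (Submodule.span ℂ[X] {(X : ℂ[X]) ^ ni}).comap (LinearMap.mulLeft ℂ[X] (X ^ (m - a) * r)) := by
    rw [Submodule.span_singleton_le_iff_mem, Submodule.mem_comap, Submodule.mem_span_singleton]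
    refine ⟨X ^ (nj + (m - a) - ni) * r, ?_⟩
    simp only [smul_eq_mul, LinearMap.mulLeft_apply]
    have : (X : ℂ[X]) ^ (nj + (m - a) - ni) * X ^ ni = X ^ (m - a) * X ^ nj := by
      rw [← pow_add, ← pow_add]; congr 1; omega
    linear_combination r * this
  refine ⟨Submodule.mapQ _ _ _ hle, ?_⟩
  rw [Submodule.mkQ_apply, Submodule.mapQ_apply, ← Submodule.mkQ_apply, ← sub_eq_zero, ← map_sub,
    aux_mk_zero]
  refine ⟨X ^ m * c, ?_⟩
  have : (X : ℂ[X]) ^ (m - a) * X ^ a = X ^ m := by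
    rw [← pow_add]; congr 1; omega
  simp only [LinearMap.mulLeft_apply]
  linear_combination p * r * this + X ^ m * hr

open DirectSum in
lemma aux_component {d : ℕ} (n : Fin d → ℕ)
    (x y : ⨁ i : Fin d, ℂ[X] ⧸ Submodule.span ℂ[X] {(X : ℂ[X]) ^ (n i)})
    (h : ∀ k l : ℕ, (∃ u, (X : ℂ[X]) ^ k • x = (X : ℂ[X]) ^ l • u) →
      ∃ u, (X : ℂ[X]) ^ k • y = (X : ℂ[X]) ^ l • u) (i : Fin d) :
    ∃ f : (⨁ i : Fin d, ℂ[X] ⧸ Submodule.span ℂ[X] {(X : ℂ[X]) ^ (n i)}) →ₗ[ℂ[X]]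
      (ℂ[X] ⧸ Submodule.span ℂ[X] {(X : ℂ[X]) ^ (n i)}), f x = y i := by
  classical
  obtain ⟨q, hq⟩ := Submodule.mkQ_surjective _ (y i)
  by_cases hq0 : X ^ (n i) ∣ q
  · refine ⟨0, ?_⟩
    rw [← hq, (aux_mk_zero _ _).2 hq0]; rfl
  have hqne : q ≠ 0 := by rintro rfl; exact hq0 (dvd_zero _)
  obtain ⟨m, q', rfl, hq'⟩ := aux_factor q hqne
  have hm : m < n i := by
    by_contra hcon
    exact hq0 (Dvd.dvd.mul_right (pow_dvd_pow _ (by omega)) _)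
  have hy : ¬ ∃ u, (X : ℂ[X]) ^ (n i - m - 1) • y = (X : ℂ[X]) ^ (n i) • u := by
    rintro ⟨u, hu⟩
    have h1 := congrArg (fun z => z i) hu
    simp only [DirectSum.smul_apply] at h1
    obtain ⟨w, hw⟩ := Submodule.mkQ_surjective _ (u i)
    rw [← hq, ← hw, ← map_smul, ← map_smul, (aux_mk_zero _ (X ^ n i • w)).2 (by simp),
      aux_mk_zero] at h1
    rw [smul_eq_mul, ← mul_assoc, ← pow_add] at h1
    have h2 : (X : ℂ[X]) ^ n i = X ^ (n i - m - 1 + m) * X := by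
      rw [← pow_succ]; congr 1; omega
    rw [h2] at h1
    exact hq' ((mul_dvd_mul_iff_left (pow_ne_zero _ X_ne_zero)).1 h1)
  have hx := fun hh => hy (h _ _ hh)
  have hj : ∃ j, ¬ ∃ u, (X : ℂ[X]) ^ (n i - m - 1) • x j = (X : ℂ[X]) ^ (n i) • u := by
    by_contra hcon
    push Not at hcon
    choose u hu using hcon
    refine hx ⟨DFinsupp.equivFunOnFintype.symm u, ?_⟩
    refine DFinsupp.ext fun j => ?_
    exact hu j
  obtain ⟨j, hj⟩ := hj
  obtain ⟨p, hp⟩ := Submodule.mkQ_surjective _ (x j)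
  have hpne : p ≠ 0 := by
    rintro rfl
    refine hj ⟨0, ?_⟩
    rw [← hp]; simp
  obtain ⟨a, p', rfl, hp'⟩ := aux_factor p hpne
  have hai : n i - m - 1 + a < n i := by
    by_contra hcon
    refine hj ⟨Submodule.mkQ _ (X ^ (n i - m - 1 + a - n i) * p'), ?_⟩
    rw [← hp, ← map_smul, ← map_smul]
    congr 1
    rw [smul_eq_mul, smul_eq_mul, ← mul_assoc, ← mul_assoc, ← pow_add, ← pow_add]
    congr 2; omega
  have haj : n i - m - 1 + a < n j := by
    by_contra hcon
    refine hj ⟨0, ?_⟩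
    rw [← hp, ← map_smul, smul_zero, aux_mk_zero, smul_eq_mul, ← mul_assoc, ← pow_add]
    exact Dvd.dvd.mul_right (pow_dvd_pow _ (by omega)) _
  obtain ⟨g, hg⟩ := aux_hom a m (n j) (n i) p' hp' (by omega) (by omega)
  refine ⟨q' • (g ∘ₗ DirectSum.component ℂ[X] (Fin d) _ j), ?_⟩
  rw [LinearMap.smul_apply, LinearMap.comp_apply]
  change q' • g (x j) = y i
  rw [← hp, hg, ← map_smul, ← hq, smul_eq_mul, mul_comm]

open DirectSum in
lemma aux_sum {d : ℕ} (n : Fin d → ℕ)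
    (x y : ⨁ i : Fin d, ℂ[X] ⧸ Submodule.span ℂ[X] {(X : ℂ[X]) ^ (n i)})
    (h : ∀ k l : ℕ, (∃ u, (X : ℂ[X]) ^ k • x = (X : ℂ[X]) ^ l • u) →
      ∃ u, (X : ℂ[X]) ^ k • y = (X : ℂ[X]) ^ l • u) :
    ∃ f : (⨁ i : Fin d, ℂ[X] ⧸ Submodule.span ℂ[X] {(X : ℂ[X]) ^ (n i)}) →ₗ[ℂ[X]]
      (⨁ i : Fin d, ℂ[X] ⧸ Submodule.span ℂ[X] {(X : ℂ[X]) ^ (n i)}), f x = y := by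
  classical
  choose f hf using aux_component n x y h
  refine ⟨(DirectSum.linearEquivFunOnFintype ℂ[X] (Fin d) _).symm.toLinearMap ∘ₗ
    LinearMap.pi f, ?_⟩
  refine DFinsupp.ext fun j => ?_
  exact hf j

/-- Full transitivity. -/
lemma aux_transitive [FiniteDimensional ℂ V] (T : V →ₗ[ℂ] V) (hT : IsNilpotent T) (x y : V)
    (h : ∀ k n : ℕ, (T ^ k) x ∈ LinearMap.range (T ^ n) → (T ^ k) y ∈ LinearMap.range (T ^ n)) :
    ∃ f : V →ₗ[ℂ] V, (∀ v, f (T v) = T (f v)) ∧ f x = y := by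
  have htor : Module.IsTorsion' (Module.AEval' T) (Submonoid.powers (X : ℂ[X])) := by
    obtain ⟨N, hN⟩ := hT
    rw [Submodule.isTorsion'_powers_iff]
    intro v
    refine ⟨N, ?_⟩
    obtain ⟨w, rfl⟩ := (Module.AEval'.of T).surjective v
    rw [Module.AEval'.X_pow_smul_of, hN]
    simp
  obtain ⟨d, n, ⟨e⟩⟩ := Module.torsion_by_prime_power_decomposition Polynomial.irreducible_X htor
  set o := Module.AEval'.of T with ho
  have key : ∀ (z : V) (k l : ℕ), (T ^ k) z ∈ LinearMap.range (T ^ l) ↔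
      ∃ u, (X : ℂ[X]) ^ k • e (o z) = (X : ℂ[X]) ^ l • u := by
    intro z k l
    constructor
    · rintro ⟨w, hw⟩
      refine ⟨e (o w), ?_⟩
      rw [← map_smul e, ← map_smul e, Module.AEval'.X_pow_smul_of, Module.AEval'.X_pow_smul_of]
      congr 2
      exact hw.symm
    · rintro ⟨u, hu⟩
      obtain ⟨u, rfl⟩ := e.surjective u
      obtain ⟨u, rfl⟩ := o.surjective u
      rw [← map_smul e, ← map_smul e, Module.AEval'.X_pow_smul_of, Module.AEval'.X_pow_smul_of] at hu
      exact ⟨u, (o.injective (e.injective hu)).symm⟩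
  obtain ⟨f, hf⟩ := aux_sum n (e (o x)) (e (o y))
    (fun k l hk => (key y k l).1 (h k l ((key x k l).2 hk)))
  let F : Module.AEval' T →ₗ[ℂ[X]] Module.AEval' T := e.symm.toLinearMap ∘ₗ f ∘ₗ e.toLinearMap
  refine ⟨o.symm.toLinearMap ∘ₗ (F.restrictScalars ℂ) ∘ₗ o.toLinearMap, ?_, ?_⟩
  · intro v
    change o.symm (F (o (T v))) = T (o.symm (F (o v)))
    rw [← Module.AEval'.of_symm_X_smul, ← map_smul, Module.AEval'.X_smul_of]
  · change o.symm (e.symm (f (e (o x)))) = y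
    rw [hf]; simp

lemma aux_comm (T : V →ₗ[ℂ] V) (m n : ℕ) (v : V) : (T ^ m) ((T ^ n) v) = (T ^ n) ((T ^ m) v) := by
  rw [← Module.End.mul_apply, ← Module.End.mul_apply, ← pow_add, ← pow_add, add_comm]

lemma aux_range_anti (T : V →ₗ[ℂ] V) {m n : ℕ} (h : m ≤ n) {v : V}
    (hv : v ∈ LinearMap.range (T ^ n)) : v ∈ LinearMap.range (T ^ m) := by
  obtain ⟨w, rfl⟩ := hv
  refine ⟨(T ^ (n - m)) w, ?_⟩
  rw [← Module.End.mul_apply, ← pow_add, Nat.add_sub_cancel' h]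

lemma aux_bdd (T : V →ₗ[ℂ] V) (hT : IsNilpotent T) {v : V} (hv : v ≠ 0) :
    BddAbove {n : ℕ | v ∈ LinearMap.range (T ^ n)} := by
  obtain ⟨N, hN⟩ := hT
  refine ⟨N, fun n hn => ?_⟩
  by_contra hcon
  have := aux_range_anti T (le_of_not_ge hcon) hn
  rw [hN] at this
  obtain ⟨w, hw⟩ := this
  exact hv (by simpa using hw.symm)

lemma aux_val_iff (T : V →ₗ[ℂ] V) (hT : IsNilpotent T) {v : V} (hv : v ≠ 0) (n : ℕ) :
    v ∈ LinearMap.range (T ^ n) ↔ n ≤ val T v := by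
  constructor
  · intro h
    exact le_csSup (aux_bdd T hT hv) h
  · intro h
    refine aux_range_anti T h ?_
    exact Nat.sSup_mem (s := {n : ℕ | v ∈ LinearMap.range (T ^ n)}) ⟨0, v, by simp⟩
      (aux_bdd T hT hv)

lemma aux_val_step (T : V →ₗ[ℂ] V) (hT : IsNilpotent T) {v : V} (k : ℕ)
    (hv : (T ^ (k + 1)) v ≠ 0) : val T ((T ^ k) v) + 1 ≤ val T ((T ^ (k + 1)) v) := by
  have hv' : (T ^ k) v ≠ 0 := by
    intro h
    rw [pow_succ', Module.End.mul_apply, h] at hv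
    exact hv (map_zero _)
  rw [← aux_val_iff T hT hv]
  obtain ⟨w, hw⟩ := (aux_val_iff T hT hv' _).2 le_rfl
  refine ⟨w, ?_⟩
  rw [pow_succ', pow_succ', Module.End.mul_apply, hw, Module.End.mul_apply]

lemma aux_ht_iff (T : V →ₗ[ℂ] V) (hT : IsNilpotent T) (v : V) (k : ℕ) :
    (T ^ k) v = 0 ↔ ht T v ≤ k := by
  constructor
  · intro h; exact Nat.sInf_le h
  · intro h
    have hne : {n : ℕ | (T ^ n) v = 0}.Nonempty := by
      obtain ⟨N, hN⟩ := hT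
      exact ⟨N, by simp [hN]⟩
    have h1 : (T ^ (ht T v)) v = 0 := Nat.sInf_mem hne
    rw [← Nat.sub_add_cancel h, pow_add, Module.End.mul_apply, h1, map_zero]

lemma aux_ht_pos (T : V →ₗ[ℂ] V) (hT : IsNilpotent T) {v : V} (hv : v ≠ 0) : 0 < ht T v := by
  by_contra h
  have := (aux_ht_iff T hT v 0).2 (by omega)
  exact hv (by simpa using this)

lemma aux_gs_lt (T : V →ₗ[ℂ] V) (hT : IsNilpotent T) {v : V} (hv : v ≠ 0) {k : ℕ}
    (hk : k ∈ gs T v) : k < ht T v := by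
  have h0 := aux_ht_pos T hT hv
  rcases hk with ⟨h1, _⟩ | h1
  · rw [Ne, aux_ht_iff T hT] at h1; omega
  · have : k = ht T v - 1 := h1
    omega

lemma aux_ht_eq (T : V →ₗ[ℂ] V) (hT : IsNilpotent T) {x y : V} (hx : x ≠ 0) (hy : y ≠ 0)
    (h : gs T x = gs T y) : ht T x = ht T y := by
  have h1 : ht T x - 1 ∈ gs T y := h ▸ Or.inr rfl
  have h2 : ht T y - 1 ∈ gs T x := h ▸ Or.inr rfl
  have h1 := aux_gs_lt T hT hy h1
  have h2 := aux_gs_lt T hT hx h2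
  omega

lemma aux_strict (T : V →ₗ[ℂ] V) (hT : IsNilpotent T) {v : V} {k l : ℕ} (hkl : k < l)
    (hl : l < ht T v) : val T ((T ^ k) v) < val T ((T ^ l) v) := by
  induction l, hkl using Nat.le_induction with
  | base =>
    have := aux_val_step T hT (v := v) k (by rw [Ne, aux_ht_iff T hT]; omega)
    simpa using this
  | succ l hkl ih =>
    have := aux_val_step T hT (v := v) l (by rw [Ne, aux_ht_iff T hT]; omega)
    have := ih (by omega)
    omega

lemma aux_val_eq (T : V →ₗ[ℂ] V) (hT : IsNilpotent T) {x y : V} (hx : x ≠ 0) (hy : y ≠ 0)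
    (hg : gs T x = gs T y) (hv : vs T x = vs T y) (k : ℕ) (hk : k < ht T x) :
    val T ((T ^ k) x) = val T ((T ^ k) y) := by
  have hht := aux_ht_eq T hT hx hy hg
  have hG : ∀ k ∈ gs T x, val T ((T ^ k) x) = val T ((T ^ k) y) := by
    have h1 : StrictMono (fun k : gs T x => val T ((T ^ (k : ℕ)) x)) := fun a b hab =>
      aux_strict T hT hab (aux_gs_lt T hT hx b.2)
    have h2 : StrictMono (fun k : gs T x => val T ((T ^ (k : ℕ)) y)) := fun a b hab =>
      aux_strict T hT hab (hht ▸ aux_gs_lt T hT hx b.2)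
    have h3 := (StrictMono.range_inj h1 h2).1 (by
      unfold vs at hv
      rw [← hg, Set.image_eq_range, Set.image_eq_range] at hv
      exact hv)
    intro k hk
    exact congrFun h3 ⟨k, hk⟩
  obtain ⟨j, hj⟩ : ∃ j, k + j + 1 = ht T x := ⟨ht T x - 1 - k, by omega⟩
  induction j generalizing k with
  | zero => exact hG k (Or.inr (show k = ht T x - 1 by omega))
  | succ j ih =>
    by_cases hkg : k ∈ gs T x
    · exact hG k hkg
    have ih := ih (k + 1) (by omega) (by omega)
    have hkg' : k ∉ gs T y := hg ▸ hkg
    have nx : (T ^ (k + 1)) x ≠ 0 := by rw [Ne, aux_ht_iff T hT]; omega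
    have ny : (T ^ (k + 1)) y ≠ 0 := by rw [Ne, aux_ht_iff T hT]; omega
    have sx := aux_val_step T hT k nx
    have sy := aux_val_step T hT k ny
    have tx : ¬ val T ((T ^ (k + 1)) x) > val T ((T ^ k) x) + 1 :=
      fun hh => hkg (Or.inl ⟨nx, hh⟩)
    have ty : ¬ val T ((T ^ (k + 1)) y) > val T ((T ^ k) y) + 1 :=
      fun hh => hkg' (Or.inl ⟨ny, hh⟩)
    omega

lemma aux_exists (T : V →ₗ[ℂ] V) [FiniteDimensional ℂ V] (hT : IsNilpotent T) {x y : V}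
    (hx : x ≠ 0) (hy : y ≠ 0) (hg : gs T x = gs T y) (hv : vs T x = vs T y) :
    ∃ f : V →ₗ[ℂ] V, (∀ v, f (T v) = T (f v)) ∧ f x = y := by
  apply aux_transitive T hT
  intro k n hk
  have hht := aux_ht_eq T hT hx hy hg
  by_cases h : (T ^ k) y = 0
  · rw [h]; exact zero_mem _
  have hkk : ¬ (T ^ k) x = 0 := by rwa [aux_ht_iff T hT, hht, ← aux_ht_iff T hT]
  rw [aux_val_iff T hT h, ← aux_val_eq T hT hx hy hg hv k
    (by rw [aux_ht_iff T hT] at hkk; omega), ← aux_val_iff T hT hkk]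
  exact hk

lemma aux_comm_pow (T f : V →ₗ[ℂ] V) (hf : ∀ v, f (T v) = T (f v)) (k : ℕ) (v : V) :
    f ((T ^ k) v) = (T ^ k) (f v) := by
  induction k with
  | zero => simp
  | succ k ih => rw [pow_succ', Module.End.mul_apply, hf, ih, Module.End.mul_apply]

lemma aux_map_cyc (T f : V →ₗ[ℂ] V) (hf : ∀ v, f (T v) = T (f v)) (x : V) :
    Submodule.map f (cyc T x) = cyc T (f x) := by
  unfold cyc
  rw [Submodule.map_span, ← Set.range_comp]
  congr 2
  funext k
  exact aux_comm_pow T f hf k x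

lemma aux_mem_cyc (T : V →ₗ[ℂ] V) (x : V) : x ∈ cyc T x :=
  Submodule.subset_span ⟨0, by simp⟩

lemma aux_cyc_zero (T : V →ₗ[ℂ] V) {y z : V} (h : y ∈ cyc T z) (k : ℕ) (hz : (T ^ k) z = 0) :
    (T ^ k) y = 0 := by
  have : cyc T z ≤ LinearMap.ker (T ^ k) := by
    unfold cyc
    rw [Submodule.span_le]
    rintro _ ⟨j, rfl⟩
    change (T ^ k) ((T ^ j) z) = 0
    rw [aux_comm, hz, map_zero]
  exact this h

lemma aux_cyc_range (T : V →ₗ[ℂ] V) {y z : V} (h : y ∈ cyc T z) (k n : ℕ)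
    (hz : (T ^ k) z ∈ LinearMap.range (T ^ n)) : (T ^ k) y ∈ LinearMap.range (T ^ n) := by
  have : cyc T z ≤ (LinearMap.range (T ^ n)).comap (T ^ k) := by
    unfold cyc
    rw [Submodule.span_le]
    rintro _ ⟨j, rfl⟩
    change (T ^ k) ((T ^ j) z) ∈ LinearMap.range (T ^ n)
    obtain ⟨w, hw⟩ := hz
    rw [aux_comm, ← hw, aux_comm]
    exact ⟨_, rfl⟩
  exact this h

lemma aux_gs_vs (T : V →ₗ[ℂ] V) {x y : V} (h0 : ∀ k, (T ^ k) x = 0 ↔ (T ^ k) y = 0)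
    (h1 : ∀ k n, (T ^ k) x ∈ LinearMap.range (T ^ n) ↔ (T ^ k) y ∈ LinearMap.range (T ^ n)) :
    gs T x = gs T y ∧ vs T x = vs T y := by
  have hval : ∀ k, val T ((T ^ k) x) = val T ((T ^ k) y) := by
    intro k; unfold val; simp only [h1]
  have hht : ht T x = ht T y := by unfold ht; simp only [h0]
  have hg : gs T x = gs T y := by unfold gs; simp only [hval, hht, ne_eq, h0]
  refine ⟨hg, ?_⟩
  unfold vs
  simp only [hg, hval]

/-- Fitting argument. -/
lemma aux_inj [FiniteDimensional ℂ V] (T : V →ₗ[ℂ] V) {x : V} (hx : x ≠ 0)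
    (hix : Indecomposable T (cyc T x)) (h : V →ₗ[ℂ] V) (hh : ∀ v, h (T v) = T (h v))
    (hhx : h x = x) : Function.Injective h := by
  obtain ⟨N, hN⟩ := Filter.eventually_atTop.1 (LinearMap.eventually_isCompl_ker_pow_range_pow h)
  have hc := hN (N + 1) (by omega)
  have hcom : ∀ v, (h ^ (N + 1)) (T v) = T ((h ^ (N + 1)) v) := fun v =>
    (aux_comm_pow h T (fun v => (hh v).symm) (N + 1) v).symm
  have hfix : ∀ m : ℕ, (h ^ m) x = x := by
    intro m
    induction m with
    | zero => simp
    | succ m ih => rw [pow_succ, Module.End.mul_apply, hhx, ih]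
  have hle : cyc T x ≤ LinearMap.range (h ^ (N + 1)) := by
    unfold cyc
    rw [Submodule.span_le]
    rintro _ ⟨j, rfl⟩
    refine ⟨(T ^ j) x, ?_⟩
    rw [aux_comm_pow T _ hcom, hfix]
  have := hix (LinearMap.ker (h ^ (N + 1))) (LinearMap.range (h ^ (N + 1)))
    (fun v hv => by rw [LinearMap.mem_ker] at hv ⊢; rw [hcom, hv, map_zero])
    (by rintro _ ⟨w, rfl⟩; exact ⟨T w, hcom w⟩) hc
    (by rw [inf_eq_left.2 hle, sup_eq_right.2 inf_le_left])
  rcases this with h1 | h1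
  · rw [LinearMap.ker_eq_bot] at h1
    intro a b hab
    apply h1
    rw [pow_succ, Module.End.mul_apply, hab, Module.End.mul_apply]
  · exfalso
    have := hle (aux_mem_cyc T x)
    rw [h1, Submodule.mem_bot] at this
    exact hx this

theorem stmt16 [FiniteDimensional ℂ V] (T : V →ₗ[ℂ] V) (hT : IsNilpotent T)
    (x y : V) (hx : x ≠ 0) (hy : y ≠ 0)
    (hix : Indecomposable T (cyc T x)) (hiy : Indecomposable T (cyc T y)) :
    (∃ f : V ≃ₗ[ℂ] V, (∀ v, f (T v) = T (f v)) ∧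
        Submodule.map (f : V →ₗ[ℂ] V) (cyc T x) = cyc T y) ↔
      (gs T x = gs T y ∧ vs T x = vs T y) := by
  constructor
  · rintro ⟨f, hf, hmap⟩
    rw [aux_map_cyc T f hf] at hmap
    have m1 : (f x) ∈ cyc T y := hmap ▸ aux_mem_cyc T (f x)
    have m2 : y ∈ cyc T (f x) := hmap.symm ▸ aux_mem_cyc T y
    have hp : ∀ k v, f ((T ^ k) v) = (T ^ k) (f v) := aux_comm_pow T f hf
    apply aux_gs_vs T
    · intro k
      rw [← f.map_eq_zero_iff, hp]
      exact ⟨aux_cyc_zero T m2 k, aux_cyc_zero T m1 k⟩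
    · intro k n
      have : (T ^ k) x ∈ LinearMap.range (T ^ n) ↔ (T ^ k) (f x) ∈ LinearMap.range (T ^ n) := by
        constructor
        · rintro ⟨w, hw⟩
          exact ⟨f w, by rw [← hp, hw, hp]⟩
        · rintro ⟨w, hw⟩
          refine ⟨f.symm w, f.injective ?_⟩
          rw [hp, hp, f.apply_symm_apply, hw]
      rw [this]
      exact ⟨aux_cyc_range T m2 k n, aux_cyc_range T m1 k n⟩
  · rintro ⟨hg, hv⟩
    obtain ⟨f, hf, hfx⟩ := aux_exists T hT hx hy hg hv
    obtain ⟨g, hg', hgy⟩ := aux_exists T hT hy hx hg.symm hv.symm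
    have hinj := aux_inj T hx hix (g ∘ₗ f) (fun v => by simp [hf, hg']) (by simp [hfx, hgy])
    have hfi : Function.Injective f := by
      intro a b hab
      apply hinj
      simp [hab]
    refine ⟨LinearEquiv.ofInjectiveEndo f hfi, fun v => ?_, ?_⟩
    · simpa using hf v
    · have : ((LinearEquiv.ofInjectiveEndo f hfi : V ≃ₗ[ℂ] V) : V →ₗ[ℂ] V) = f := by
        ext v; simp
      rw [this, aux_map_cyc T f hf, hfx]
end
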